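/- Let (x_n)_{n≥1} be a sequence of pairwise distinct integers. Then for Lebesgue-almost all k ∈ ℝ, the sequence of fractional parts ({x_n k})_{n≥1} is uniformly distributed in [0,1]. -/

import Mathlib

open Real Finset Filter MeasureTheory

/-- A sequence (y_n)_{n≥1} of reals in [0,1] is uniformly distributed in [0,1] if for
all 0 ≤ a < b ≤ 1 the proportion of n ≤ N with y_n ∈ [a,b) tends to b − a. -/
def UniformlyDistributed (y : ℕ → ℝ) : Prop :=
  ∀ a b : ℝ, 0 ≤ a → a < b → b ≤ 1 →
    Tendsto (fun N : ℕ =>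
        (((Finset.Icc 1 N).filter (fun n => y n ∈ Set.Ico a b)).card : ℝ) / N)
      atTop (nhds (b - a))

open AddCircle

theorem haarAddCircle_one_eq_volume : (haarAddCircle : Measure (AddCircle (1 : ℝ))) = volume := by
  rw [AddCircle.volume_eq_smul_haarAddCircle]
  simp

theorem integral_fourier_one (n : ℤ) :
    ∫ θ : AddCircle (1 : ℝ), fourier n θ ∂haarAddCircle = if n = 0 then 1 else 0 := by
  split_ifs with h
  · simp [h]
  · exact integral_eq_zero_of_add_right_eq_neg (fourier_add_half_inv_index h one_pos)

theorem integral_norm_sum_fourier_sq {ι : Type*} (s : Finset ι) (c : ι → ℤ)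
    (hc : Set.InjOn c s) :
    ∫ θ : AddCircle (1 : ℝ), ‖∑ n ∈ s, fourier (c n) θ‖ ^ 2 ∂haarAddCircle = s.card := by
  classical
  have key : ∀ θ : AddCircle (1 : ℝ), ((‖∑ n ∈ s, fourier (c n) θ‖ ^ 2 : ℝ) : ℂ) =
      ∑ n ∈ s, ∑ m ∈ s, fourier (c n - c m) θ := by
    intro θ
    push_cast
    rw [← Complex.mul_conj', map_sum, Finset.sum_mul_sum]
    simp_rw [sub_eq_add_neg, fourier_add, fourier_neg]
  have hint : ∀ n : ℤ, Integrable (fun θ : AddCircle (1 : ℝ) => fourier n θ) haarAddCircle :=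
    fun n => (fourier n).continuous.integrable_of_hasCompactSupport
      (HasCompactSupport.of_compactSpace _)
  apply Complex.ofReal_injective
  rw [← integral_complex_ofReal]
  simp_rw [key]
  rw [integral_finsetSum _ fun n _ => integrable_finsetSum _ fun m _ => hint _]
  simp_rw [integral_finsetSum _ fun m _ => hint _, integral_fourier_one, sub_eq_zero]
  have : ∀ n ∈ s, (∑ m ∈ s, if c n = c m then (1 : ℂ) else 0) = 1 := by
    intro n hn
    rw [Finset.sum_eq_single_of_mem n hn]
    · simp
    · intro m hm hmn
      rw [if_neg fun h => hmn (hc hm hn h.symm)]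
  rw [Finset.sum_congr rfl this]
  simp

theorem tendsto_average_of_tendsto_average_sq {u : ℕ → ℂ} (hu : ∀ n, ‖u n‖ ≤ 1)
    (h : Tendsto (fun m : ℕ => ‖∑ n ∈ Finset.Icc 1 (m ^ 2), u n‖ / (m : ℝ) ^ 2) atTop (nhds 0)) :
    Tendsto (fun N : ℕ => (N : ℂ)⁻¹ * ∑ n ∈ Finset.Icc 1 N, u n) atTop (nhds 0) := by
  have hsqrt : Tendsto Nat.sqrt atTop atTop :=
    tendsto_atTop_atTop.2 fun b => ⟨b * b, fun a ha => Nat.le_sqrt.2 ha⟩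
  have h2 : Tendsto (fun m : ℕ => 2 / (m : ℝ)) atTop (nhds 0) :=
    tendsto_const_div_atTop_nhds_zero_nat 2
  have h3 := (h.add h2).comp hsqrt
  rw [add_zero] at h3
  refine squeeze_zero_norm' ?_ h3
  filter_upwards [eventually_ge_atTop 1] with N hN
  set m := Nat.sqrt N with hm
  have hm1 : 1 ≤ m := Nat.le_sqrt.2 (by simpa using hN)
  have hmN : m ^ 2 ≤ N := Nat.sqrt_le' N
  have hNm : N ≤ m ^ 2 + 2 * m := by
    have := Nat.sqrt_le_add N
    rw [← hm] at this
    nlinarith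
  have hm0 : (0 : ℝ) < m := by exact_mod_cast hm1
  have hmN' : (m : ℝ) ^ 2 ≤ N := by exact_mod_cast hmN
  have hsplit : ∑ n ∈ Finset.Icc 1 N, u n =
      ∑ n ∈ Finset.Icc 1 (m ^ 2), u n + ∑ n ∈ Finset.Ioc (m ^ 2) N, u n := by
    have hI : ∀ k, Finset.Icc 1 k = Finset.Ioc 0 k := fun k => by ext; simp [Nat.succ_le_iff]
    rw [hI, hI, Finset.sum_Ioc_consecutive _ (Nat.zero_le _) hmN]
  have htail : ‖∑ n ∈ Finset.Ioc (m ^ 2) N, u n‖ ≤ 2 * m := by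
    refine (norm_sum_le_of_le _ fun n _ => hu n).trans ?_
    simp only [Finset.sum_const, Nat.card_Ioc, nsmul_eq_mul, mul_one]
    exact_mod_cast (by omega : N - m ^ 2 ≤ 2 * m)
  have hbound : ‖∑ n ∈ Finset.Icc 1 N, u n‖ ≤ ‖∑ n ∈ Finset.Icc 1 (m ^ 2), u n‖ + 2 * m := by
    rw [hsplit]
    exact (norm_add_le _ _).trans (by gcongr)
  simp only [Function.comp_apply, norm_mul, norm_inv, Complex.norm_natCast]
  rw [← hm]
  calc (N : ℝ)⁻¹ * ‖∑ n ∈ Finset.Icc 1 N, u n‖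
      ≤ ((m : ℝ) ^ 2)⁻¹ * (‖∑ n ∈ Finset.Icc 1 (m ^ 2), u n‖ + 2 * m) := by gcongr
    _ = _ := by field_simp

theorem ae_tendsto_average_fourier {c : ℕ → ℤ} (hc : Set.InjOn c (Set.Ici 1)) :
    ∀ᵐ θ : AddCircle (1 : ℝ) ∂haarAddCircle,
      Tendsto (fun N : ℕ => (N : ℂ)⁻¹ * ∑ n ∈ Finset.Icc 1 N, fourier (c n) θ) atTop (nhds 0) := by
  let S : ℕ → AddCircle (1 : ℝ) → ℝ :=
    fun m θ => ‖∑ n ∈ Finset.Icc 1 (m ^ 2), fourier (c n) θ‖ / (m : ℝ) ^ 2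
  have hcont : ∀ m, Continuous (fun θ => S m θ ^ 2) := fun m => by
    have : Continuous fun θ : AddCircle (1 : ℝ) => ∑ n ∈ Finset.Icc 1 (m ^ 2), fourier (c n) θ :=
      continuous_finsetSum _ fun n _ => (fourier (c n)).continuous
    exact (this.norm.div_const _).pow 2
  have hS : ∀ m, ∫⁻ θ, ENNReal.ofReal (S m θ ^ 2) ∂haarAddCircle =
      ENNReal.ofReal (1 / (m : ℝ) ^ 2) := by
    intro m
    rw [← ofReal_integral_eq_lintegral_ofReal
      ((hcont m).integrable_of_hasCompactSupport (HasCompactSupport.of_compactSpace _))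
      (Eventually.of_forall fun θ => sq_nonneg _)]
    congr 1
    simp only [S, div_pow]
    rw [integral_div, integral_norm_sum_fourier_sq _ _ (hc.mono fun n hn => by simp_all)]
    rcases eq_or_ne m 0 with rfl | hm
    · simp
    · simp
      field_simp
  have hsum : ∫⁻ θ, ∑' m, ENNReal.ofReal (S m θ ^ 2) ∂haarAddCircle ≠ ⊤ := by
    rw [lintegral_tsum fun m => (hcont m).measurable.ennreal_ofReal.aemeasurable]
    simp_rw [hS]
    exact (Real.summable_one_div_nat_pow.2 one_lt_two).tsum_ofReal_ne_top
  have hmeas : Measurable fun θ => ∑' m, ENNReal.ofReal (S m θ ^ 2) :=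
    Measurable.tsum fun m => (hcont m).measurable.ennreal_ofReal
  filter_upwards [ae_lt_top hmeas hsum] with θ hθ
  refine tendsto_average_of_tendsto_average_sq (fun n => ?_) ?_
  · exact ((fourier (c n)).norm_coe_le_norm θ).trans (fourier_norm _).le
  · have h0 := (ENNReal.tendsto_toReal ENNReal.zero_ne_top).comp
      (ENNReal.tendsto_atTop_zero_of_tsum_ne_top hθ.ne)
    have h1 := h0.sqrt
    simpa [Function.comp_def, ENNReal.toReal_ofReal, sq_nonneg, Real.sqrt_sq, S,
      div_nonneg, sq_abs, abs_of_nonneg] using h1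

theorem tendsto_average_of_tendsto_average_fourier {y : ℕ → AddCircle (1 : ℝ)}
    (hy : ∀ h : ℤ, h ≠ 0 →
      Tendsto (fun N : ℕ => (N : ℂ)⁻¹ * ∑ n ∈ Finset.Icc 1 N, fourier h (y n)) atTop (nhds 0))
    (f : C(AddCircle (1 : ℝ), ℂ)) :
    Tendsto (fun N : ℕ => (N : ℂ)⁻¹ * ∑ n ∈ Finset.Icc 1 N, f (y n)) atTop
      (nhds (∫ θ, f θ ∂haarAddCircle)) := by
  have hint : ∀ g : C(AddCircle (1 : ℝ), ℂ), Integrable (fun θ => g θ) haarAddCircle :=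
    fun g => g.continuous.integrable_of_hasCompactSupport (HasCompactSupport.of_compactSpace _)
  have hspan : ∀ g ∈ Submodule.span ℂ (Set.range (@fourier 1)),
      Tendsto (fun N : ℕ => (N : ℂ)⁻¹ * ∑ n ∈ Finset.Icc 1 N, g (y n)) atTop
        (nhds (∫ θ, g θ ∂haarAddCircle)) := by
    intro g hg
    induction hg using Submodule.span_induction with
    | mem g hg =>
      obtain ⟨h, rfl⟩ := hg
      rw [integral_fourier_one]
      split_ifs with h0
      · refine tendsto_const_nhds.congr' ?_
        filter_upwards [eventually_ne_atTop 0] with N hN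
        have : (N : ℂ) ≠ 0 := by exact_mod_cast hN
        simp [h0, this]
      · exact hy h h0
    | zero => simp
    | add g₁ g₂ _ _ h₁ h₂ =>
      simpa [Finset.sum_add_distrib, mul_add, integral_add (hint g₁) (hint g₂)] using h₁.add h₂
    | smul a g _ h =>
      simpa [← Finset.mul_sum, mul_left_comm, integral_const_mul] using h.const_mul a
  have hf : f ∈ closure
      (Submodule.span ℂ (Set.range (@fourier 1)) : Set C(AddCircle (1 : ℝ), ℂ)) := by
    rw [← Submodule.topologicalClosure_coe, span_fourier_closure_eq_top]
    trivial
  rw [Metric.tendsto_atTop]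
  intro ε hε
  obtain ⟨g, hg, hfg⟩ := Metric.mem_closure_iff.1 hf (ε / 3) (by positivity)
  obtain ⟨N₀, hN₀⟩ := Metric.tendsto_atTop.1 (hspan g hg) (ε / 3) (by positivity)
  have hpt : ∀ θ, ‖f θ - g θ‖ ≤ ε / 3 := fun θ => by
    rw [← dist_eq_norm]
    exact (ContinuousMap.dist_apply_le_dist θ).trans hfg.le
  refine ⟨N₀, fun N hN => ?_⟩
  have h1 : dist ((N : ℂ)⁻¹ * ∑ n ∈ Finset.Icc 1 N, f (y n))
      ((N : ℂ)⁻¹ * ∑ n ∈ Finset.Icc 1 N, g (y n)) ≤ ε / 3 := by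
    rw [dist_eq_norm, ← mul_sub, ← Finset.sum_sub_distrib, norm_mul, norm_inv,
      Complex.norm_natCast]
    have : ‖∑ n ∈ Finset.Icc 1 N, (f (y n) - g (y n))‖ ≤ N * (ε / 3) := by
      refine (norm_sum_le_of_le _ fun n _ => hpt (y n)).trans ?_
      simp
    rcases Nat.eq_zero_or_pos N with rfl | hN
    · simp; positivity
    · have : (0 : ℝ) < N := by exact_mod_cast hN
      rw [inv_mul_le_iff₀ this]
      assumption
  have h2 : dist (∫ θ, g θ ∂haarAddCircle) (∫ θ, f θ ∂haarAddCircle) ≤ ε / 3 := by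
    rw [dist_comm, dist_eq_norm, ← integral_sub (hint f) (hint g)]
    refine (norm_integral_le_of_norm_le_const (Eventually.of_forall hpt)).trans ?_
    simp
  have h3 := hN₀ N hN
  have h4 := dist_triangle4 ((N : ℂ)⁻¹ * ∑ n ∈ Finset.Icc 1 N, f (y n))
      ((N : ℂ)⁻¹ * ∑ n ∈ Finset.Icc 1 N, g (y n)) (∫ θ, g θ ∂haarAddCircle)
      (∫ θ, f θ ∂haarAddCircle)
  linarith

theorem AddCircle.exists_intCast_eq_sub_of_coe_eq {s t : ℝ}
    (h : (s : AddCircle (1 : ℝ)) = (t : AddCircle (1 : ℝ))) : ∃ n : ℤ, (n : ℝ) = s - t := by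
  rw [← sub_eq_zero, ← AddCircle.coe_sub, AddCircle.coe_eq_zero_iff] at h
  simpa using h

theorem AddCircle.volume_one_singleton (θ : AddCircle (1 : ℝ)) : volume {θ} = 0 := by
  rw [← Metric.closedBall_zero, AddCircle.volume_closedBall]
  simp

theorem AddCircle.volume_one_image_Ico {a b : ℝ} (hab : a < b) (hb : b ≤ a + 1) :
    volume (((↑) : ℝ → AddCircle (1 : ℝ)) '' Set.Ico a b) = ENNReal.ofReal (b - a) := by
  have hmeas : MeasurableSet (((↑) : ℝ → AddCircle (1 : ℝ)) '' Set.Ico a b) := by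
    rw [← Set.Ioo_union_left hab, Set.image_union, Set.image_singleton]
    exact (QuotientAddGroup.isOpenMap_coe _ isOpen_Ioo).measurableSet.union
      (measurableSet_singleton _)
  rw [AddCircle.add_projection_respects_measure 1 (b - 1) hmeas]
  refine le_antisymm ?_ ?_
  · rw [← Real.volume_Icc]
    refine measure_mono ?_
    rintro y ⟨⟨t, ht, hty⟩, hy⟩
    obtain ⟨n, hn⟩ := AddCircle.exists_intCast_eq_sub_of_coe_eq hty.symm
    have hy1 := hy.1
    have hy2 := hy.2
    have hn0 : -1 < n := by
      have : (-1 : ℝ) < n := by linarith [ht.2]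
      exact_mod_cast this
    rcases (show n = 0 ∨ 1 ≤ n by omega) with rfl | hn1
    · push_cast at hn
      constructor <;> linarith [ht.1, ht.2]
    · have : (1 : ℝ) ≤ n := by exact_mod_cast hn1
      constructor <;> linarith [ht.1, ht.2]
  · rw [← Real.volume_Ioo]
    refine measure_mono fun y hy => ⟨⟨y, ⟨hy.1.le, hy.2⟩, rfl⟩, ?_, ?_⟩ <;> linarith [hy.1, hy.2]

theorem AddCircle.volume_one_frontier_image_Ico (a b : ℝ) :
    volume (frontier (((↑) : ℝ → AddCircle (1 : ℝ)) '' Set.Ico a b)) = 0 := by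
  refine measure_mono_null (t := {(a : AddCircle (1 : ℝ))} ∪ {(b : AddCircle (1 : ℝ))}) ?_
    (measure_union_null (volume_one_singleton _) (volume_one_singleton _))
  rintro θ ⟨hcl, hint⟩
  have hclosed : IsClosed (((↑) : ℝ → AddCircle (1 : ℝ)) '' Set.Icc a b) :=
    (isCompact_Icc.image (AddCircle.continuous_mk' 1)).isClosed
  obtain ⟨t, ht, rfl⟩ := closure_minimal (Set.image_mono Set.Ico_subset_Icc_self) hclosed hcl
  rcases ht.1.eq_or_lt with rfl | h1
  · exact Or.inl rfl
  rcases ht.2.eq_or_lt with rfl | h2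
  · exact Or.inr rfl
  exact absurd (interior_maximal (Set.image_mono Set.Ioo_subset_Ico_self)
    (QuotientAddGroup.isOpenMap_coe _ isOpen_Ioo) ⟨t, ⟨h1, h2⟩, rfl⟩) hint

theorem fract_mem_Ico_iff {a b : ℝ} (ha : 0 ≤ a) (hb : b ≤ 1) (y : ℝ) :
    Int.fract y ∈ Set.Ico a b ↔
      (y : AddCircle (1 : ℝ)) ∈ ((↑) : ℝ → AddCircle (1 : ℝ)) '' Set.Ico a b := by
  constructor
  · intro h
    refine ⟨_, h, ?_⟩
    rw [← sub_eq_zero, ← AddCircle.coe_sub, AddCircle.coe_eq_zero_iff]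
    exact ⟨-⌊y⌋, by simp [← Int.self_sub_floor]⟩
  · rintro ⟨t, ht, hty⟩
    obtain ⟨n, hn⟩ := AddCircle.exists_intCast_eq_sub_of_coe_eq hty.symm
    have hfract : Int.fract y = t :=
      Int.fract_eq_iff.2 ⟨by linarith [ht.1], by linarith [ht.2], n, by linarith⟩
    rwa [hfract]

theorem uniformlyDistributed_fract_of_tendsto_average {y : ℕ → ℝ}
    (hy : ∀ f : C(AddCircle (1 : ℝ), ℂ),
      Tendsto (fun N : ℕ => (N : ℂ)⁻¹ * ∑ n ∈ Finset.Icc 1 N, f (y n)) atTop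
        (nhds (∫ θ, f θ ∂haarAddCircle))) :
    UniformlyDistributed fun n => Int.fract (y n) := by
  intro a b ha hab hb
  let μ : ℕ → Measure (AddCircle (1 : ℝ)) := fun N =>
    ((N + 1 : ℕ) : ENNReal)⁻¹ • ∑ n ∈ Finset.Icc 1 (N + 1), Measure.dirac (y n : AddCircle (1 : ℝ))
  have hμ : ∀ N, IsProbabilityMeasure (μ N) := fun N => ⟨by
    simp only [μ, Measure.smul_apply, Measure.finsetSum_apply, measure_univ, smul_eq_mul]
    simp only [Finset.sum_const, Nat.card_Icc, nsmul_eq_mul, mul_one, Nat.add_sub_cancel]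
    exact ENNReal.inv_mul_cancel (by simp) (by simp)⟩
  let P : ℕ → ProbabilityMeasure (AddCircle (1 : ℝ)) := fun N => ⟨μ N, hμ N⟩
  let Q : ProbabilityMeasure (AddCircle (1 : ℝ)) := ⟨haarAddCircle, inferInstance⟩
  have hP : Tendsto P atTop (nhds Q) := by
    rw [ProbabilityMeasure.tendsto_iff_forall_integral_rclike_tendsto ℂ]
    intro f
    refine ((tendsto_add_atTop_iff_nat 1).2 (hy f.toContinuousMap)).congr fun N => ?_
    simp only [P, μ, ProbabilityMeasure.coe_mk]
    rw [integral_smul_measure, integral_finsetSum_measure]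
    · simp [-Nat.cast_add]
    · exact fun n _ => f.integrable _
  have hE := ProbabilityMeasure.tendsto_measure_of_null_frontier_of_tendsto' hP
    (E := ((↑) : ℝ → AddCircle (1 : ℝ)) '' Set.Ico a b)
    (by
      simp only [Q, ProbabilityMeasure.coe_mk, haarAddCircle_one_eq_volume]
      exact AddCircle.volume_one_frontier_image_Ico a b)
  simp only [P, Q, ProbabilityMeasure.coe_mk, haarAddCircle_one_eq_volume] at hE
  rw [AddCircle.volume_one_image_Ico hab (by linarith)] at hE
  have hE' := (ENNReal.tendsto_toReal ENNReal.ofReal_ne_top).comp hE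
  rw [ENNReal.toReal_ofReal (by linarith)] at hE'
  rw [← tendsto_add_atTop_iff_nat 1]
  refine hE'.congr fun N => ?_
  have hcard : ∑ n ∈ Finset.Icc 1 (N + 1), Measure.dirac (y n : AddCircle (1 : ℝ))
      (((↑) : ℝ → AddCircle (1 : ℝ)) '' Set.Ico a b) =
      ((Finset.Icc 1 (N + 1)).filter fun n => Int.fract (y n) ∈ Set.Ico a b).card := by
    classical
    simp_rw [Measure.dirac_apply, Set.indicator_apply, ← fract_mem_Ico_iff ha hb, Pi.one_apply]
    rw [Finset.sum_boole]
  simp only [Function.comp_apply, μ, Measure.smul_apply, Measure.finsetSum_apply, smul_eq_mul,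
    hcard, ENNReal.toReal_mul, ENNReal.toReal_inv, ENNReal.toReal_natCast]
  rw [inv_mul_eq_div]

theorem ae_coe_addCircle {p : AddCircle (1 : ℝ) → Prop} (hp : ∀ᵐ θ ∂haarAddCircle, p θ) :
    ∀ᵐ k : ℝ ∂volume, p (k : AddCircle (1 : ℝ)) := by
  rw [haarAddCircle_one_eq_volume] at hp
  have h : ∀ᵐ k : ℝ ∂volume.restrict (⋃ n : ℤ, Set.Ioc (n : ℝ) (n + 1)), p k := by
    rw [ae_restrict_iUnion_iff]
    exact fun n => (AddCircle.measurePreserving_mk 1 (n : ℝ)).quasiMeasurePreserving.ae hp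
  rwa [iUnion_Ioc_intCast, Measure.restrict_univ] at h

/-- If (x_n)_{n≥1} are pairwise distinct integers, then for Lebesgue-almost all k ∈ ℝ
the fractional parts ({x_n k})_{n≥1} are uniformly distributed in [0,1]. -/
theorem unifDist_of_distinct_integers (x : ℕ → ℤ)
    (hx : ∀ m n : ℕ, 1 ≤ m → 1 ≤ n → x m = x n → m = n) :
    ∀ᵐ k : ℝ ∂volume, UniformlyDistributed (fun n => Int.fract ((x n : ℝ) * k)) := by
  have hall : ∀ᵐ θ : AddCircle (1 : ℝ) ∂haarAddCircle, ∀ h : ℤ, h ≠ 0 →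
      Tendsto (fun N : ℕ => (N : ℂ)⁻¹ * ∑ n ∈ Finset.Icc 1 N, fourier (h * x n) θ)
        atTop (nhds 0) := by
    rw [ae_all_iff]
    intro h
    by_cases h0 : h = 0
    · simp [h0]
    · filter_upwards [ae_tendsto_average_fourier (c := fun n => h * x n)
        fun m hm n hn hmn => hx m n hm hn (mul_left_cancel₀ h0 hmn)] with θ hθ _ using hθ
  filter_upwards [ae_coe_addCircle hall] with k hk
  refine uniformlyDistributed_fract_of_tendsto_average fun f =>
    tendsto_average_of_tendsto_average_fourier (fun h h0 => ?_) f
  have hcoe : ∀ n, fourier h (((x n : ℝ) * k : ℝ) : AddCircle (1 : ℝ)) =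
      fourier (h * x n) (k : AddCircle (1 : ℝ)) := fun n => by
    rw [fourier_apply, fourier_apply, mul_smul, ← zsmul_eq_mul, AddCircle.coe_zsmul]
  simpa only [hcoe] using hk h h0
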